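/- arXiv:1909.06698 — 2 statements merged into one kernel-verified Lean document; each statement's English description precedes it below -/
import Mathlib

section
/- If G is a t-edge-connected simple graph of order n ≥ 2 and k is a positive integer with k ≤ n−1 and k ≤ t, then the k-token graph F_k(G) is at least k(t−k+1)-edge-connected. -/
open Finset SimpleGraph

open scoped Classical

variable {V : Type*}

/-- The `k`-token graph of `G`: vertices are the `k`-subsets of `V(G)`, two of them
adjacent iff their symmetric difference is a pair of adjacent vertices of `G`. -/
def tokenGraph [DecidableEq V] (G : SimpleGraph V) (k : ℕ) :
    SimpleGraph {s : Finset V // s.card = k} :=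
  SimpleGraph.fromRel fun A B => ∃ a b, G.Adj a b ∧ symmDiff A.1 B.1 = {a, b}

/-- `G` is `t`-edge-connected: removing fewer than `t` edges leaves it connected. -/
def EdgeConnected (G : SimpleGraph V) (t : ℕ) : Prop :=
  ∀ F : Finset (Sym2 V), F.card < t → (G.deleteEdges (F : Set (Sym2 V))).Connected

/-- Edge-connectivity `λ(G)`. -/
noncomputable def edgeConn (G : SimpleGraph V) : ℕ :=
  sSup {t | EdgeConnected G t}

/-- `G` is `t`-vertex-connected. -/
def VertexConnected [Fintype V] (G : SimpleGraph V) (t : ℕ) : Prop :=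
  t < Fintype.card V ∧
    ∀ S : Finset V, S.card < t → (G.induce ((↑(Sᶜ) : Set V))).Connected

/-- Vertex-connectivity `κ(G)`. -/
noncomputable def vertexConn [Fintype V] (G : SimpleGraph V) : ℕ :=
  sSup {t | VertexConnected G t}


theorem swap_eq [DecidableEq V] {C : Finset V} {c : V} (a : V) (hc : c ∈ C) :
    insert c (insert a (C.erase c)) = insert a C := by
  rw [Finset.insert_comm, Finset.insert_erase hc]

theorem swap_card [DecidableEq V] {C : Finset V} {c a : V} {m : ℕ} (hC : C.card = m) (hc : c ∈ C)
    (ha : a ∉ C) : (insert a (C.erase c)).card = m := by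
  rw [Finset.card_insert_of_notMem (fun h => ha (Finset.mem_of_mem_erase h)),
    Finset.card_erase_add_one hc, hC]

theorem swap_self [DecidableEq V] {C : Finset V} {c a : V} (hc : c ∈ C) (ha : a ∉ C) :
    c ∉ insert a (C.erase c) := by
  have : c ≠ a := fun h => ha (h ▸ hc)
  simp [this]

theorem swap_other [DecidableEq V] {C : Finset V} {c a x : V} (hx : x ∉ C) (hxa : x ≠ a) :
    x ∉ insert a (C.erase c) := by
  simp [hx, hxa]

theorem token_slide [DecidableEq V] (H : SimpleGraph V) (N : Finset V) (m : ℕ) (P : Finset V → Prop)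
    (hN : ∀ u v, H.Adj u v → u ∉ N)
    (hmove : ∀ (R : Finset V) (u v : V), R.card = m → Disjoint R N → u ∉ R → v ∉ R → H.Adj u v →
      (P (insert u R) → P (insert v R)))
    {p q : V} (w : H.Walk p q) : ∀ C : Finset V, C.card = m → Disjoint C N → p ∉ C → q ∉ C →
      q ∉ N → (P (insert p C) → P (insert q C)) := by
  induction w with
  | nil => intro C _ _ _ _ _ h; exact h
  | @cons p r q hpr w ih =>
    intro C hC hCN hp hq hqN h
    by_cases hpq : p = q
    · subst hpq; exact h
    by_cases hr : r ∈ C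
    · have hprne : p ≠ r := hpr.ne
      have hpN := hN _ _ hpr
      have h1 : insert r (insert p (C.erase r)) = insert p C := by grind
      have h2 := ih (insert p (C.erase r)) (by grind) (by
        rw [Finset.disjoint_left] at hCN ⊢; grind) (by grind) (by grind) hqN (by rw [h1]; exact h)
      have h3 : insert q (insert p (C.erase r)) = insert p (insert q (C.erase r)) := by grind
      rw [h3] at h2
      have h4 := hmove (insert q (C.erase r)) p r (by grind) (by
        rw [Finset.disjoint_left] at hCN ⊢; grind) (by grind) (by grind) hpr h2
      have h5 : insert r (insert q (C.erase r)) = insert q C := by grind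
      rwa [h5] at h4
    · exact ih C hC hCN hr hq hqN (hmove C p r hC hCN hp hr hpr h)

theorem cut_bound [DecidableEq V] (G : SimpleGraph V) (t : ℕ) (hG : EdgeConnected G t)
    (X : V → Prop) (a b : V) (ha : X a) (hb : ¬ X b) (D : Finset (Finset V))
    (hD : ∀ u v, G.Adj u v → X u → ¬ X v → ({u, v} : Finset V) ∈ D) : t ≤ D.card := by
  by_contra hlt
  push Not at hlt
  let g : Finset V → Sym2 V := fun E => if h : ∃ e : Sym2 V, e.toFinset = E then h.choose else s(a, a)
  have hg : ∀ u v, g {u, v} = s(u, v) := by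
    intro u v
    have h : ∃ e : Sym2 V, e.toFinset = {u, v} := ⟨s(u, v), by ext; simp⟩
    have h1 : g {u, v} = h.choose := by simp only [g]; rw [dif_pos h]
    rw [h1]
    have h2 := h.choose_spec
    apply Sym2.ext
    intro x
    rw [← Sym2.mem_toFinset, h2]; simp
  have hc := hG (D.image g) (lt_of_le_of_lt Finset.card_image_le hlt)
  obtain ⟨w⟩ := hc.preconnected a b
  have key : ∀ {x y : V} (w : (G.deleteEdges ((D.image g : Finset (Sym2 V)) : Set (Sym2 V))).Walk x y),
      X x → X y := by
    intro x y w
    induction w with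
    | nil => exact id
    | @cons x r y hxr w ih =>
      intro hx
      apply ih
      by_contra hr
      rw [SimpleGraph.deleteEdges_adj] at hxr
      apply hxr.2
      have := hD x r hxr.1 hx hr
      rw [← hg]
      exact_mod_cast Finset.mem_image_of_mem g this
  exact hb (key w ha)

/-- The special token edges, indexed by pairs `(c, x)`. -/
def Spec [DecidableEq V] (C : Finset V) (a b : V) (i : V × V) (z : Finset V × Finset V) : Prop :=
  (i = (a, b) ∧ z = (C, {a, b})) ∨
  (i.1 ∈ C ∧ i.2 ≠ b ∧ i.2 ∉ C ∧ i.2 ≠ a ∧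
    (z = (insert a (C.erase i.1), {i.1, i.2}) ∨ z = (insert i.2 (C.erase i.1), {a, b}) ∨
      z = (insert b (C.erase i.1), {i.1, i.2}))) ∨
  (i.1 ∈ C ∧ i.2 = b ∧
    (z = (insert a (C.erase i.1), {i.1, b}) ∨ z = (insert b (C.erase i.1), {a, i.1})))

theorem pair_eq' [DecidableEq V] {a b c d : V} (h : ({a, b} : Finset V) = {c, d}) :
    (a = c ∧ b = d) ∨ (a = d ∧ b = c) := by
  have h1 : a ∈ ({c, d} : Finset V) := by rw [← h]; simp
  have h2 : b ∈ ({c, d} : Finset V) := by rw [← h]; simp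
  have h3 : c ∈ ({a, b} : Finset V) := by rw [h]; simp
  have h4 : d ∈ ({a, b} : Finset V) := by rw [h]; simp
  simp only [Finset.mem_insert, Finset.mem_singleton] at h1 h2 h3 h4
  grind

theorem Spec_unique [DecidableEq V] (C : Finset V) (a b : V) (ha : a ∉ C) (hb : b ∉ C) (hab : a ≠ b)
    (i j : V × V) (z : Finset V × Finset V) (hi : Spec C a b i z) (hj : Spec C a b j z) : i = j := by
  obtain ⟨c, x⟩ := i
  obtain ⟨d, y⟩ := j
  obtain ⟨R, E⟩ := z
  simp only [Spec, Prod.mk.injEq] at hi hj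
  have hmem : ∀ e w : V, e ∈ C → w ∉ C → ∀ u, u ∈ insert w (C.erase e) ↔ (u = w ∨ (u ≠ e ∧ u ∈ C)) := by
    intros; simp
  rcases hi with ⟨⟨rfl, rfl⟩, rfl, rfl⟩ | ⟨hc, hx, hx2, hx3, (⟨rfl, rfl⟩ | ⟨rfl, rfl⟩ | ⟨rfl, rfl⟩)⟩ |
      ⟨hc, rfl, (⟨rfl, rfl⟩ | ⟨rfl, rfl⟩)⟩ <;>
  rcases hj with ⟨⟨rfl, rfl⟩, h1, h2⟩ | ⟨hd, hy, hy2, hy3, (⟨h1, h2⟩ | ⟨h1, h2⟩ | ⟨h1, h2⟩)⟩ |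
      ⟨hd, rfl, (⟨h1, h2⟩ | ⟨h1, h2⟩)⟩ <;>
  (first
    | rfl
    | (have h2' := pair_eq' h2
       have h1' := Finset.ext_iff.mp h1
       simp only [Finset.mem_insert, Finset.mem_erase] at h1'
       grind))

set_option maxHeartbeats 1600000 in
theorem core_bound [Fintype V] [DecidableEq V] (G : SimpleGraph V) (t m : ℕ)
    (hG : EdgeConnected G t) (hmt : m + 1 ≤ t) (P : Finset V → Prop)
    (Q : Finset (Finset V × Finset V))
    (hQ : ∀ (R : Finset V) (u v : V), R.card = m → u ∉ R → v ∉ R → G.Adj u v →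
      P (insert u R) → ¬ P (insert v R) → (R, ({u, v} : Finset V)) ∈ Q)
    (C : Finset V) (a b : V) (hC : C.card = m) (ha : a ∉ C) (hb : b ∉ C) (hadj : G.Adj a b)
    (hPa : P (insert a C)) (hPb : ¬ P (insert b C)) :
    (m + 1) * (t - m) ≤ Q.card := by
  have hab : a ≠ b := hadj.ne
  have hQ' : ∀ (R : Finset V) (u v : V), R.card = m → u ∉ R → v ∉ R → G.Adj u v →
      (R, ({u, v} : Finset V)) ∉ Q → (P (insert u R) ↔ P (insert v R)) := by
    intro R u v h1 h2 h3 h4 h5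
    constructor
    · intro h; by_contra h'; exact h5 (hQ R u v h1 h2 h3 h4 h h')
    · intro h; by_contra h'; rw [Finset.pair_comm] at h5; exact h5 (hQ R v u h1 h3 h2 h4.symm h h')
  let T : V → Finset V := fun c => univ.filter fun x => G.Adj c x ∧ x ≠ a ∧ x ∉ C ∧ (x = b → G.Adj c a)
  let I : Finset (V × V) := insert (a, b) (C.biUnion fun c => (T c).image fun x => (c, x))
  have hT : ∀ c ∈ C, t - m ≤ (T c).card := by
    intro c hc
    have hca : c ≠ a := by rintro rfl; exact ha hc
    let y := if G.Adj c a then a else b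
    have h1 := cut_bound G t hG (fun v => v = c) c a rfl hca.symm
      (((T c) ∪ (C.erase c) ∪ {y}).image fun x => ({c, x} : Finset V)) (by
        rintro u v huv rfl hv
        refine Finset.mem_image_of_mem _ ?_
        simp only [T, y, Finset.mem_union, Finset.mem_filter, Finset.mem_univ, true_and,
          Finset.mem_erase, Finset.mem_singleton]
        by_cases h1 : G.Adj u a <;> simp only [h1, if_true, if_false] <;> grind)
    have h2 := h1.trans Finset.card_image_le
    have h3 := Finset.card_union_le (T c ∪ C.erase c) {y}
    have h4 := Finset.card_union_le (T c) (C.erase c)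
    rw [Finset.card_erase_of_mem hc] at h4
    have h5 : 0 < C.card := Finset.card_pos.mpr ⟨c, hc⟩
    simp only [Finset.card_singleton] at h3
    omega
  have hI : 1 + m * (t - m) ≤ I.card := by
    have h1 : (a, b) ∉ (C.biUnion fun c => (T c).image fun x => (c, x)) := by
      simp only [Finset.mem_biUnion, Finset.mem_image, Prod.mk.injEq]; grind
    rw [Finset.card_insert_of_notMem h1, Finset.card_biUnion]
    · have : ∑ c ∈ C, (t - m) ≤ ∑ c ∈ C, ((T c).image fun x => (c, x)).card := by
        apply Finset.sum_le_sum
        intro c hc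
        rw [Finset.card_image_of_injective _ (fun x y h => (Prod.mk.inj h).2)]
        exact hT c hc
      rw [Finset.sum_const, hC, smul_eq_mul] at this
      omega
    · intro c _ d _ hcd
      change Disjoint _ _
      rw [Finset.disjoint_left]
      simp only [Finset.mem_image]
      rintro ⟨_, _⟩ ⟨x, _, hx⟩ ⟨y, _, hy⟩
      simp only [Prod.mk.injEq] at hx hy
      exact hcd (hx.1.trans hy.1.symm)
  have hex : ∀ i ∈ I, ∃ z ∈ Q, Spec C a b i z := by
    rintro ⟨c, x⟩ hi
    simp only [I, Finset.mem_insert, Finset.mem_biUnion, Finset.mem_image] at hi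
    rcases hi with hi | ⟨c', hc', x', hx', heq⟩
    · exact ⟨(C, {a, b}), hQ C a b hC ha hb hadj hPa hPb, Or.inl ⟨hi, rfl⟩⟩
    · simp only [Prod.mk.injEq] at heq
      obtain ⟨rfl, rfl⟩ := heq
      simp only [T, Finset.mem_filter, Finset.mem_univ, true_and] at hx'
      obtain ⟨hcx, hxa, hxC, hxb⟩ := hx'
      have hpos : 0 < C.card := Finset.card_pos.mpr ⟨c', hc'⟩
      by_cases hx : x' = b
      · subst hx
        by_contra hno
        push Not at hno
        have n1 := fun h => hno (insert a (C.erase c'), {c', x'}) h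
          (Or.inr (Or.inr ⟨hc', rfl, Or.inl rfl⟩))
        have n2 := fun h => hno (insert x' (C.erase c'), {a, c'}) h
          (Or.inr (Or.inr ⟨hc', rfl, Or.inr rfl⟩))
        have e1 := hQ' _ c' x' (swap_card hC hc' ha) (swap_self hc' ha) (swap_other hxC hxa) hcx n1
        have e2 := hQ' _ a c' (swap_card hC hc' hb) (swap_other ha hxa.symm) (swap_self hc' hb) (hxb rfl).symm n2
        have s1 : insert c' (insert a (C.erase c')) = insert a C := swap_eq _ hc'
        have s2 : insert c' (insert x' (C.erase c')) = insert x' C := swap_eq _ hc'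
        have s3 : insert x' (insert a (C.erase c')) = insert a (insert x' (C.erase c')) := Finset.insert_comm _ _ _
        rw [s1, s3] at e1
        rw [s2] at e2
        exact hPb (e2.mp (e1.mp hPa))
      · by_contra hno
        push Not at hno
        have n1 := fun h => hno (insert a (C.erase c'), {c', x'}) h
          (Or.inr (Or.inl ⟨hc', hx, hxC, hxa, Or.inl rfl⟩))
        have n2 := fun h => hno (insert x' (C.erase c'), {a, b}) h
          (Or.inr (Or.inl ⟨hc', hx, hxC, hxa, Or.inr (Or.inl rfl)⟩))
        have n3 := fun h => hno (insert b (C.erase c'), {c', x'}) h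
          (Or.inr (Or.inl ⟨hc', hx, hxC, hxa, Or.inr (Or.inr rfl)⟩))
        have e1 := hQ' _ c' x' (swap_card hC hc' ha) (swap_self hc' ha) (swap_other hxC hxa) hcx n1
        have e2 := hQ' _ a b (swap_card hC hc' hxC) (swap_other ha (Ne.symm hxa)) (swap_other hb (Ne.symm hx)) hadj n2
        have e3 := hQ' _ c' x' (swap_card hC hc' hb) (swap_self hc' hb) (swap_other hxC hx) hcx n3
        have s1 : insert c' (insert a (C.erase c')) = insert a C := swap_eq _ hc'
        have s2 : insert x' (insert a (C.erase c')) = insert a (insert x' (C.erase c')) := Finset.insert_comm _ _ _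
        have s3 : insert c' (insert b (C.erase c')) = insert b C := swap_eq _ hc'
        have s4 : insert x' (insert b (C.erase c')) = insert b (insert x' (C.erase c')) := Finset.insert_comm _ _ _
        rw [s1, s2] at e1
        rw [s3, s4] at e3
        exact hPb (e3.mpr (e2.mp (e1.mp hPa)))
  let S := Q.filter fun z => ∃ i, Spec C a b i z
  let Z := Q.filter fun z => ¬ ∃ i, Spec C a b i z
  have hSZ : S.card + Z.card = Q.card := Finset.card_filter_add_card_filter_not _
  have hIS : I.card ≤ S.card := by
    choose! h hh using hex
    apply Finset.card_le_card_of_injOn h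
    · intro i hi
      simp only [S, Finset.coe_filter, Set.mem_setOf_eq]
      exact ⟨(hh i hi).1, i, (hh i hi).2⟩
    · intro i hi j hj hij
      apply Spec_unique C a b ha hb hab i j (h i) (hh i hi).2
      rw [hij]; exact (hh j hj).2
  let D : Finset (Finset V) := Z.image Prod.snd
  have hZD : ∀ R E, (R, E) ∈ Q → (∀ i, ¬ Spec C a b i (R, E)) → E ∈ D := by
    intro R E h1 h2
    refine Finset.mem_image.mpr ⟨(R, E), ?_, rfl⟩
    simp only [Z, Finset.mem_filter]
    exact ⟨h1, fun ⟨i, hi⟩ => h2 i hi⟩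
  let H : SimpleGraph V := SimpleGraph.fromRel fun u v =>
    G.Adj u v ∧ u ≠ a ∧ u ≠ b ∧ v ≠ a ∧ v ≠ b ∧ ({u, v} : Finset V) ∉ D
  have hH : ∀ u v, H.Adj u v ↔ G.Adj u v ∧ u ≠ a ∧ u ≠ b ∧ v ≠ a ∧ v ≠ b ∧ ({u, v} : Finset V) ∉ D := by
    intro u v
    simp only [H, SimpleGraph.fromRel_adj]
    constructor
    · rintro ⟨_, h | h⟩
      · exact h
      · rw [Finset.pair_comm]; exact ⟨h.1.symm, h.2.2.2.1, h.2.2.2.2.1, h.2.1, h.2.2.1, h.2.2.2.2.2⟩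
    · intro h; exact ⟨h.1.ne, Or.inl h⟩
  let X : V → Prop := fun v => v = a ∨ (v ≠ a ∧ v ≠ b ∧
    ∃ p, p ∉ C ∧ p ≠ b ∧ G.Adj a p ∧ ({a, p} : Finset V) ∉ D ∧ H.Reachable p v)
  let e : V → Finset V := fun c => if X c then {c, b} else {a, c}
  have hcut := cut_bound G t hG X a b (Or.inl rfl) (by rintro (h | h); exacts [hab h.symm, h.2.1 rfl])
    (insert {a, b} (D ∪ C.image e)) (by
      intro u v huv hu hv
      simp only [Finset.mem_insert, Finset.mem_union, Finset.mem_image]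
      by_contra hno
      push Not at hno
      obtain ⟨hno1, hno2, hno3⟩ := hno
      rcases hu with rfl | ⟨hua, hub, p, hpC, hpb, hap, hapD, hreach⟩
      · by_cases hvb : v = b
        · subst hvb; exact hno1 rfl
        by_cases hvC : v ∈ C
        · apply hno3 v hvC; simp only [e]; rw [if_neg hv]
        · exact hv (Or.inr ⟨huv.ne', hvb, v, hvC, hvb, huv, hno2, SimpleGraph.Reachable.refl _⟩)
      · have hva : v ≠ a := fun h => hv (Or.inl h)
        by_cases hvb : v = b
        · subst hvb
          by_cases huC : u ∈ C
          · apply hno3 u huC; simp only [e]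
            rw [if_pos]
            exact Or.inr ⟨hua, hub, p, hpC, hpb, hap, hapD, hreach⟩
          · skip
            have hpa : p ≠ a := hap.ne'
            have n1 : (C, ({a, p} : Finset V)) ∉ Q := fun h => hapD (hZD _ _ h (by
              rintro ⟨c, x⟩ hs
              simp only [Spec, Prod.mk.injEq] at hs
              rcases hs with ⟨_, _, hs⟩ | ⟨_, _, _, _, (⟨hs, _⟩ | ⟨hs, _⟩ | ⟨hs, _⟩)⟩ |
                ⟨_, _, (⟨hs, _⟩ | ⟨hs, _⟩)⟩
              · have := pair_eq' hs; grind
              all_goals grind))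
            have n2 : (C, ({u, v} : Finset V)) ∉ Q := fun h => hno2 (hZD _ _ h (by
              rintro ⟨c, x⟩ hs
              simp only [Spec, Prod.mk.injEq] at hs
              rcases hs with ⟨_, _, hs⟩ | ⟨_, _, _, _, (⟨hs, _⟩ | ⟨hs, _⟩ | ⟨hs, _⟩)⟩ |
                ⟨_, _, (⟨hs, _⟩ | ⟨hs, _⟩)⟩
              · have := pair_eq' hs; grind
              all_goals grind))
            have e1 := (hQ' C a p hC ha hpC hap n1).mp hPa
            obtain ⟨w⟩ := hreach
            have e2 := token_slide H {a, v} m P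
              (by intro x y hxy; have := (hH x y).mp hxy; simp [this.2.1, this.2.2.1])
              (by
                intro R x y hR hRN hx hy hxy
                have hxy' := (hH x y).mp hxy
                rw [Finset.disjoint_left] at hRN
                have haR : a ∉ R := fun h => hRN h (by simp)
                have hbR : v ∉ R := fun h => hRN h (by simp)
                refine (hQ' R x y hR hx hy hxy'.1 fun h => hxy'.2.2.2.2.2 (hZD _ _ h ?_)).mp
                rintro ⟨c, z⟩ hs
                simp only [Spec, Prod.mk.injEq] at hs
                rcases hs with ⟨_, _, hs⟩ | ⟨_, _, _, _, (⟨hs, _⟩ | ⟨_, hs⟩ | ⟨hs, _⟩)⟩ |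
                  ⟨_, _, (⟨hs, _⟩ | ⟨hs, _⟩)⟩
                · have := pair_eq' hs; grind
                · grind
                · have := pair_eq' hs; grind
                all_goals grind)
              w C hC (by rw [Finset.disjoint_left]; grind) hpC huC (by grind) e1
            exact hPb ((hQ' C u v hC huC hb huv n2).mp e2)
        · apply hv
          refine Or.inr ⟨hva, hvb, p, hpC, hpb, hap, hapD, hreach.trans ?_⟩
          exact SimpleGraph.Adj.reachable ((hH u v).mpr ⟨huv, hua, hub, hva, hvb, hno2⟩))
  have c1 := Finset.card_insert_le ({a, b} : Finset V) (D ∪ C.image e)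
  have c2 := Finset.card_union_le D (C.image e)
  have c3 : (C.image e).card ≤ C.card := Finset.card_image_le
  have c4 : D.card ≤ Z.card := Finset.card_image_le
  have c5 : (m + 1) * (t - m) = m * (t - m) + (t - m) := by ring
  omega

theorem exists_cross [Fintype V] [DecidableEq V] (G : SimpleGraph V) (m : ℕ)
    (hG : G.Connected) (P : Finset V → Prop)
    (hmove : ∀ (R : Finset V) (u v : V), R.card = m → u ∉ R → v ∉ R → G.Adj u v →
      P (insert u R) → P (insert v R)) :
    ∀ (d : ℕ) (A B : Finset V), A.card = m + 1 → B.card = m + 1 → (A \ B).card = d → P A → P B := by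
  intro d
  induction d with
  | zero =>
    intro A B hA hB hd h
    have : A ⊆ B := by rwa [Finset.card_eq_zero, Finset.sdiff_eq_empty_iff_subset] at hd
    rwa [← Finset.eq_of_subset_of_card_le this (by omega)]
  | succ d ih =>
    intro A B hA hB hd h
    have hd' : (B \ A).card = d + 1 := by
      rw [← hd]; exact Finset.card_sdiff_comm (by omega)
    obtain ⟨x, hx⟩ := Finset.card_pos.mp (by omega : 0 < (A \ B).card)
    obtain ⟨y, hy⟩ := Finset.card_pos.mp (by omega : 0 < (B \ A).card)
    rw [Finset.mem_sdiff] at hx hy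
    obtain ⟨w⟩ := hG.preconnected x y
    have h1 := token_slide G ∅ m P (by simp)
      (fun R u v h1 _ h2 h3 h4 => hmove R u v h1 h2 h3 h4) w (A.erase x)
      (by rw [Finset.card_erase_of_mem hx.1]; omega) (by simp) (by simp) (by grind) (by simp)
      (by rwa [Finset.insert_erase hx.1])
    refine ih _ B ?_ hB ?_ h1
    · exact swap_card hA hx.1 hy.2
    · have : insert y (A.erase x) \ B = (A \ B).erase x := by
        clear ih hmove
        ext z
        simp only [Finset.mem_sdiff, Finset.mem_insert, Finset.mem_erase]
        grind
      rw [this, Finset.card_erase_of_mem (Finset.mem_sdiff.mpr hx), hd]; rfl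

theorem stmt0 [Fintype V] [DecidableEq V] (G : SimpleGraph V) (n t k : ℕ)
    (hn : Fintype.card V = n) (hn2 : 2 ≤ n) (hG : EdgeConnected G t)
    (hk1 : 1 ≤ k) (hkn : k ≤ n - 1) (hkt : k ≤ t) :
    EdgeConnected (tokenGraph G k) (k * (t - k + 1)) := by
  obtain ⟨m, rfl⟩ : ∃ m, k = m + 1 := ⟨k - 1, by omega⟩
  intro F hF
  have hconn : G.Connected := by
    have := hG ∅ (by simp; omega)
    simpa using this
  obtain ⟨A0, -, hA0⟩ := Finset.exists_subset_card_eq (s := (univ : Finset V)) (n := m + 1)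
    (by rw [Finset.card_univ]; omega)
  haveI : Nonempty {s : Finset V // s.card = m + 1} := ⟨⟨A0, hA0⟩⟩
  refine SimpleGraph.Connected.mk ?_
  rintro ⟨A, hA⟩ ⟨B, hB⟩
  by_contra hnr
  let K := (tokenGraph G (m + 1)).deleteEdges (F : Set (Sym2 {s : Finset V // s.card = m + 1}))
  let P : Finset V → Prop := fun s => ∃ h : s.card = m + 1, K.Reachable ⟨A, hA⟩ ⟨s, h⟩
  have hPA : P A := ⟨hA, SimpleGraph.Reachable.refl _⟩
  have hPB : ¬ P B := fun ⟨_, h⟩ => hnr h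
  let ψ : Sym2 {s : Finset V // s.card = m + 1} → Finset V × Finset V :=
    Sym2.lift ⟨fun X Y => (X.1 ∩ Y.1, symmDiff X.1 Y.1), fun X Y => by
      beta_reduce; rw [Finset.inter_comm, symmDiff_comm]⟩
  have hQ : ∀ (R : Finset V) (u v : V), R.card = m → u ∉ R → v ∉ R → G.Adj u v →
      P (insert u R) → ¬ P (insert v R) → (R, ({u, v} : Finset V)) ∈ F.image ψ := by
    intro R u v hR hu hv huv hPu hPv
    obtain ⟨hcu, hru⟩ := hPu
    have hcv : (insert v R).card = m + 1 := by rw [Finset.card_insert_of_notMem hv, hR]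
    have huv' := huv.ne
    have hsd : symmDiff (insert u R) (insert v R) = {u, v} := by
      ext x; simp only [Finset.mem_symmDiff, Finset.mem_insert, Finset.mem_singleton]; grind
    have hin : insert u R ∩ insert v R = R := by grind
    refine Finset.mem_image.mpr ⟨s(⟨insert u R, hcu⟩, ⟨insert v R, hcv⟩), ?_, ?_⟩
    · by_contra hnF
      apply hPv
      refine ⟨hcv, hru.trans (SimpleGraph.Adj.reachable ?_)⟩
      simp only [K, SimpleGraph.deleteEdges_adj]
      refine ⟨?_, by exact_mod_cast hnF⟩
      rw [tokenGraph, SimpleGraph.fromRel_adj]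
      refine ⟨?_, Or.inl ⟨u, v, huv, hsd⟩⟩
      intro h
      have := congrArg Subtype.val h
      simp only at this
      have h3 : u ∈ insert v R := by rw [← this]; simp
      grind
    · simp only [ψ, Sym2.lift_mk, hin, hsd]
  have : ∃ (R : Finset V) (u v : V), R.card = m ∧ u ∉ R ∧ v ∉ R ∧ G.Adj u v ∧
      P (insert u R) ∧ ¬ P (insert v R) := by
    by_contra hno
    push Not at hno
    exact hPB (exists_cross G m hconn P hno _ A B hA hB rfl hPA)
  obtain ⟨R, u, v, hR, hu, hv, huv, hPu, hPv⟩ := this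
  have h1 := core_bound G t m hG hkt P (F.image ψ) hQ R u v hR hu hv huv hPu hPv
  have h2 : (F.image ψ).card ≤ F.card := Finset.card_image_le
  have h3 : t - (m + 1) + 1 = t - m := by omega
  rw [h3] at hF
  omega
end

section
/- Let G be a connected simple graph of order n, and let k be a positive integer with k ≤ n−1 and k ≤ λ(G). If δ(F_k(G)) = k(λ(G)−k+1), then λ(F_k(G)) = δ(F_k(G)). -/
open Finset SimpleGraph

open scoped Classical

variable {V : Type*}

open Relation in
theorem aux_move [DecidableEq V] (R : V → V → Prop) (f : Finset V → Prop) (m : ℕ) (W : V → Prop)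
    (hN : ∀ (T : Finset V) u v, T.card = m → (∀ z ∈ T, W z) → u ∉ T → v ∉ T → R u v →
      (f (insert u T) ↔ f (insert v T)))
    (hW : ∀ u v, R u v → W u) (y : V) (hy : W y) (x : V)
    (h : ReflTransGen R x y) :
    ∀ S : Finset V, S.card = m → (∀ z ∈ S, W z) → x ∉ S → y ∉ S →
      (f (insert x S) ↔ f (insert y S)) := by
  induction h using ReflTransGen.head_induction_on with
  | refl => intros; rfl
  | head hxz _ ih =>
    rename_i x z _
    intro S hS hSW hxS hyS
    by_cases hz : z ∈ S
    · by_cases hyx : y = x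
      · rw [hyx]
      have hzy : z ≠ y := fun e => hyS (e ▸ hz)
      have hzx : z ≠ x := fun e => hxS (e ▸ hz)
      have h1 : insert x S = insert z (insert x (S.erase z)) := by
        ext w; simp only [mem_insert, mem_erase]; by_cases w = z <;> simp_all
      have hpos : 0 < S.card := Finset.card_pos.mpr ⟨z, hz⟩
      have h2 := ih (insert x (S.erase z))
        (by rw [card_insert_of_notMem (by simp [hxS]), card_erase_of_mem hz]; omega)
        (by
          intro w hw
          rcases mem_insert.1 hw with rfl | hw
          · exact hW _ _ hxz
          · exact hSW _ (mem_of_mem_erase hw))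
        (by simp [hzx]) (by simp [hyx, hyS])
      have h3 := hN (insert y (S.erase z)) x z
        (by rw [card_insert_of_notMem (by simp [hyS]), card_erase_of_mem hz]; omega)
        (by
          intro w hw
          rcases mem_insert.1 hw with rfl | hw
          · exact hy
          · exact hSW _ (mem_of_mem_erase hw))
        (by simp [hxS, Ne.symm hyx]) (by simp [hzy]) hxz
      have h4 : insert y S = insert z (insert y (S.erase z)) := by
        ext w; simp only [mem_insert, mem_erase]; by_cases w = z <;> simp_all
      rw [h1, h2, h4, ← h3, Finset.insert_comm]
    · rw [hN S x z hS hSW hxS hz hxz]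
      exact ih S hS hSW hz hyS

theorem aux_const [DecidableEq V] (G : SimpleGraph V) (hG : G.Connected) (f : Finset V → Prop)
    (m : ℕ)
    (hN : ∀ (T : Finset V) u v, T.card = m → u ∉ T → v ∉ T → G.Adj u v →
      (f (insert u T) ↔ f (insert v T))) :
    ∀ (d : ℕ) (A B : Finset V), A.card = m + 1 → B.card = m + 1 → (A \ B).card = d →
      (f A ↔ f B) := by
  intro d
  induction d with
  | zero =>
    intro A B hA hB h
    have : A ⊆ B := by simpa [sdiff_eq_empty_iff_subset] using h
    rw [eq_of_subset_of_card_le this (by omega)]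
  | succ d ih =>
    intro A B hA hB h
    have hBA : (B \ A).card = d + 1 := by
      have h1 := card_sdiff_add_card_inter A B
      have h2 := card_sdiff_add_card_inter B A
      rw [inter_comm] at h2
      omega
    obtain ⟨x, hx⟩ : (A \ B).Nonempty := Finset.card_pos.mp (by omega)
    obtain ⟨y, hy⟩ : (B \ A).Nonempty := Finset.card_pos.mp (by omega)
    have hx' := hx
    rw [mem_sdiff] at hx hy
    have hr : Relation.ReflTransGen G.Adj x y :=
      (SimpleGraph.reachable_iff_reflTransGen x y).1 (hG.preconnected x y)
    have h1 := aux_move G.Adj f m (fun _ => True) (fun T u v h _ => hN T u v h)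
      (fun _ _ _ => trivial) y trivial x hr (A.erase x)
      (by rw [card_erase_of_mem hx.1]; omega) (by simp) (by simp) (by simp [hy.2])
    rw [insert_erase hx.1] at h1
    rw [h1]
    apply ih _ _ _ hB
    · have : insert y (A.erase x) \ B = (A \ B).erase x := by
        ext w; simp only [mem_sdiff, mem_insert, mem_erase]
        constructor
        · rintro ⟨rfl | h, h'⟩
          · exact absurd hy.1 h'
          · exact ⟨h.1, h.2, h'⟩
        · rintro ⟨h, h', h''⟩; exact ⟨Or.inr ⟨h, h'⟩, h''⟩
      rw [this, card_erase_of_mem hx']; omega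
    · rw [card_insert_of_notMem (by simp [hy.2]), card_erase_of_mem hx.1]; omega

theorem aux_cut (G : SimpleGraph V) (t : ℕ) (h : EdgeConnected G t) (U : V → Prop) (a b : V)
    (ha : U a) (hb : ¬ U b) (F : Finset (Sym2 V))
    (hF : ∀ u v, U u → ¬ U v → G.Adj u v → s(u, v) ∈ F) : t ≤ F.card := by
  by_contra hlt
  have hc := h F (by omega)
  have hr : Relation.ReflTransGen (G.deleteEdges (F : Set (Sym2 V))).Adj a b :=
    (SimpleGraph.reachable_iff_reflTransGen a b).1 (hc.preconnected a b)
  apply hb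
  clear hb
  induction hr with
  | refl => exact ha
  | tail _ hyz ih =>
    by_contra hz
    rw [SimpleGraph.deleteEdges_adj] at hyz
    exact hyz.2 (by simpa using hF _ _ ih hz hyz.1)

theorem aux_deg (G : SimpleGraph V) (t : ℕ) (h : EdgeConnected G t) (v w : V) (hvw : v ≠ w)
    (N : Finset V) (hN : ∀ u, G.Adj v u → u ∈ N) : t ≤ N.card := by
  refine (aux_cut G t h (fun u => u = v) v w rfl (Ne.symm hvw) (N.image fun u => s(v, u)) ?_).trans
    card_image_le
  rintro u x rfl _ hux
  exact mem_image_of_mem _ (hN _ hux)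

def auxP1 (S : Finset V) (a b : V) (e : Sym2 V) : Prop := ∃ s ∈ S, e = s(a, s) ∨ e = s(b, s)

def auxQ2 [DecidableEq V] (S : Finset V) (a b s w : V) (p : Finset V × Sym2 V) : Prop :=
  p = (insert a (S.erase s), s(s, w)) ∨ p = (insert b (S.erase s), s(s, w)) ∨
    p = (insert w (S.erase s), s(a, b))

def auxP2 [DecidableEq V] (S : Finset V) (a b : V) (p : Finset V × Sym2 V) : Prop :=
  ∃ s w, s ∈ S ∧ w ∉ S ∧ w ≠ a ∧ w ≠ b ∧ auxQ2 S a b s w p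

/-- The lower bound on the remaining class. -/
theorem aux_rest [DecidableEq V] (G : SimpleGraph V) (t k : ℕ) (h : EdgeConnected G t)
    (f : Finset V → Prop) (Z : Finset (Finset V × Sym2 V))
    (hZ : ∀ (T : Finset V) u v, T.card + 1 = k → u ∉ T → v ∉ T → G.Adj u v →
      f (insert u T) → ¬ f (insert v T) → (T, s(u, v)) ∈ Z)
    (S : Finset V) (a b : V) (hS : S.card + 1 = k) (ha : a ∉ S) (hb : b ∉ S) (hab : G.Adj a b)
    (hfa : f (insert a S)) (hfb : ¬ f (insert b S)) :
    t ≤ (Z.filter fun p => p.2 ≠ s(a, b) ∧ ¬ auxP1 S a b p.2 ∧ ¬ auxP2 S a b p).card + k := by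
  set Z3 := Z.filter fun p => p.2 ≠ s(a, b) ∧ ¬ auxP1 S a b p.2 ∧ ¬ auxP2 S a b p with hZ3
  set L := Z3.image Prod.snd with hL
  let G3 : V → V → Prop := fun u v => G.Adj u v ∧ s(u, v) ∉ L ∧ s(u, v) ≠ s(a, b) ∧
    ¬ auxP1 S a b s(u, v)
  let H : V → V → Prop := fun u v => G3 u v ∧ (u ≠ a ∧ u ≠ b) ∧ (v ≠ a ∧ v ≠ b)
  have half : ∀ (T : Finset V) u v, T.card + 1 = k → u ∉ T → v ∉ T → G3 u v →
      ¬ auxP2 S a b (T, s(u, v)) → f (insert u T) → f (insert v T) := by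
    intro T u v hT hu hv huv hP hfu
    by_contra hfv
    apply huv.2.1
    exact mem_image.2 ⟨(T, s(u, v)), mem_filter.2
      ⟨hZ T u v hT hu hv huv.1 hfu hfv, huv.2.2.1, huv.2.2.2, hP⟩, rfl⟩
  have G3symm : ∀ u v, G3 u v → G3 v u := by
    intro u v huv
    have e : s(v, u) = s(u, v) := Sym2.eq_swap
    refine ⟨huv.1.symm, ?_, ?_, ?_⟩ <;> rw [e]
    exacts [huv.2.1, huv.2.2.1, huv.2.2.2]
  have neut : ∀ (T : Finset V) u v, T.card + 1 = k → u ∉ T → v ∉ T → G3 u v →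
      ¬ auxP2 S a b (T, s(u, v)) → (f (insert u T) ↔ f (insert v T)) := by
    intro T u v hT hu hv huv hP
    refine ⟨half T u v hT hu hv huv hP, half T v u hT hv hu (G3symm _ _ huv) ?_⟩
    rwa [Sym2.eq_swap]
  -- moves inside
  have inner : ∀ x y, Relation.ReflTransGen H x y → (y ≠ a ∧ y ≠ b) → x ∉ S → y ∉ S →
      (f (insert x S) ↔ f (insert y S)) := by
    intro x y hxy hy hx hyS
    refine aux_move H f (k - 1) (fun z => z ≠ a ∧ z ≠ b) ?_ (fun u v h => h.2.1) y hy x hxy S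
      (by omega) ?_ hx hyS
    · intro T u v hT hTW hu hv huv
      refine neut T u v (by omega) hu hv huv.1 ?_
      rintro ⟨s, w, hs, hw, hwa, hwb, h | h | h⟩
      · have := (Prod.mk.inj h).1
        exact (hTW a (by rw [this]; simp)).1 rfl
      · have := (Prod.mk.inj h).1
        exact (hTW b (by rw [this]; simp)).2 rfl
      · exact huv.1.2.2.1 (Prod.mk.inj h).2
    · intro z hz
      exact ⟨fun e => ha (e ▸ hz), fun e => hb (e ▸ hz)⟩
  have hane : a ≠ b := hab.ne
  have nbS : ∀ c x, (c = a ∨ c = b) → G3 c x → x ∉ S ∧ x ≠ a ∧ x ≠ b := by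
    intro c x hc hcx
    refine ⟨?_, ?_, ?_⟩
    · intro hxS
      apply hcx.2.2.2
      rcases hc with rfl | rfl
      · exact ⟨x, hxS, Or.inl rfl⟩
      · exact ⟨x, hxS, Or.inr rfl⟩
    · rintro rfl
      rcases hc with rfl | rfl
      · exact hcx.1.ne rfl
      · exact hcx.2.2.1 Sym2.eq_swap
    · rintro rfl
      rcases hc with rfl | rfl
      · exact hcx.2.2.1 rfl
      · exact hcx.1.ne rfl
  have outer : ∀ c x, (c = a ∨ c = b) → G3 c x → (f (insert c S) ↔ f (insert x S)) := by
    intro c x hc hcx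
    obtain ⟨hxS, hxa, hxb⟩ := nbS c x hc hcx
    have hcS : c ∉ S := by rcases hc with rfl | rfl <;> assumption
    refine neut S c x hS hcS hxS hcx ?_
    rintro ⟨s, w, hs, hw, hwa, hwb, h | h | h⟩
    · have := (Prod.mk.inj h).1
      exact ha (by rw [this]; simp)
    · have := (Prod.mk.inj h).1
      exact hb (by rw [this]; simp)
    · exact hcx.2.2.1 (Prod.mk.inj h).2
  let U : V → Prop := fun v => v = a ∨ ∃ x, G3 a x ∧ Relation.ReflTransGen H x v
  have hUb : ¬ U b := by
    rintro (h | ⟨x, hax, hxb⟩)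
    · exact hane h.symm
    · rcases Relation.ReflTransGen.cases_tail hxb with h | ⟨c, _, hcb⟩
      · exact (nbS a x (Or.inl rfl) hax).2.2 h.symm
      · exact hcb.2.2.2 rfl
  let Fc : Finset (Sym2 V) := L ∪ ({s(a, b)} ∪ S.image fun s => if U s then s(b, s) else s(a, s))
  have hFc : Fc.card ≤ Z3.card + k := by
    have h1 : L.card ≤ Z3.card := card_image_le
    have h2 : (S.image fun s => if U s then s(b, s) else s(a, s)).card ≤ S.card := card_image_le
    have h3 := card_union_le L ({s(a, b)} ∪ S.image fun s => if U s then s(b, s) else s(a, s))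
    have h4 := card_union_le {s(a, b)} (S.image fun s => if U s then s(b, s) else s(a, s))
    rw [card_singleton] at h4
    show (L ∪ ({s(a, b)} ∪ S.image fun s => if U s then s(b, s) else s(a, s))).card ≤ _
    omega
  refine (aux_cut G t h U a b (Or.inl rfl) hUb Fc ?_).trans hFc
  intro u v hu hv huv
  by_contra hn
  simp only [Fc, mem_union, mem_singleton, mem_image, not_or, not_exists, not_and] at hn
  obtain ⟨hn1, hn2, hn3⟩ := hn
  have hg : G3 u v := by
    refine ⟨huv, hn1, hn2, ?_⟩
    rintro ⟨s, hs, e | e⟩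
    · have hsU : ¬ U s := by
        rcases Sym2.eq_iff.1 e with ⟨rfl, rfl⟩ | ⟨rfl, rfl⟩
        · exact hv
        · exact absurd (Or.inl rfl) hv
      apply hn3 s hs
      rw [if_neg hsU, e]
    · have hsU : U s := by
        rcases Sym2.eq_iff.1 e with ⟨rfl, rfl⟩ | ⟨rfl, rfl⟩
        · exact absurd hu hUb
        · exact hu
      apply hn3 s hs
      rw [if_pos hsU, e]
  have hva : v ≠ a := fun e => hv (Or.inl e)
  have hub : u ≠ b := fun e => hUb (e ▸ hu)
  rcases hu with rfl | ⟨x, hax, hxu⟩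
  · exact hv (Or.inr ⟨v, hg, .refl⟩)
  · by_cases hua : u = a
    · subst hua
      exact hv (Or.inr ⟨v, hg, .refl⟩)
    by_cases hvb : v = b
    · subst hvb
      have g' := G3symm _ _ hg
      have huS := (nbS v u (Or.inr rfl) g').1
      have hxS := (nbS a x (Or.inl rfl) hax).1
      apply hfb
      rw [outer v u (Or.inr rfl) g', ← inner x u hxu ⟨hua, hub⟩ hxS huS,
        ← outer a x (Or.inl rfl) hax]
      exact hfa
    · exact hv (Or.inr ⟨x, hax, hxu.tail ⟨hg, ⟨hua, hub⟩, ⟨hva, hvb⟩⟩⟩)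

theorem aux_Q2_inj [DecidableEq V] (S : Finset V) (a b : V) (ha : a ∉ S) (hb : b ∉ S)
    (s w s' w' : V) (hs : s ∈ S) (hw : w ∉ S) (hs' : s' ∈ S) (hw' : w' ∉ S)
    (p : Finset V × Sym2 V) (h : auxQ2 S a b s w p) (h' : auxQ2 S a b s' w' p) :
    s = s' ∧ w = w' := by
  have key : s(s, w) = s(s', w') → s = s' ∧ w = w' := by
    intro e
    rcases Sym2.eq_iff.1 e with h | ⟨rfl, rfl⟩
    · exact h
    · exact absurd hs hw'
  have key2 : ∀ s w, s ∈ S → s(s, w) ≠ s(a, b) := by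
    intro s w hs e
    rcases Sym2.eq_iff.1 e with ⟨rfl, rfl⟩ | ⟨rfl, rfl⟩
    · exact ha hs
    · exact hb hs
  rcases h with h | h | h <;> rcases h' with h' | h' | h' <;> rw [h] at h' <;>
    obtain ⟨e1, e2⟩ := Prod.mk.inj h'
  · exact key e2
  · exact key e2
  · exact absurd e2 (key2 _ _ hs)
  · exact key e2
  · exact key e2
  · exact absurd e2 (key2 _ _ hs)
  · exact absurd e2.symm (key2 _ _ hs')
  · exact absurd e2.symm (key2 _ _ hs')
  · constructor
    · by_contra hne
      have : s' ∈ insert w (S.erase s) := by simp [hs', Ne.symm hne]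
      rw [e1] at this
      simp only [mem_insert, mem_erase] at this
      rcases this with h | h
      · exact hw' (h ▸ hs')
      · exact h.1 rfl
    · have : w ∈ insert w (S.erase s) := by simp
      rw [e1] at this
      simp only [mem_insert, mem_erase] at this
      rcases this with h | h
      · exact h
      · exact absurd h.2 hw

theorem aux_core [Fintype V] [DecidableEq V] (G : SimpleGraph V) (t k : ℕ) (h : EdgeConnected G t)
    (hkt : k ≤ t)
    (f : Finset V → Prop) (Z : Finset (Finset V × Sym2 V))
    (hZ : ∀ (T : Finset V) u v, T.card + 1 = k → u ∉ T → v ∉ T → G.Adj u v →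
      f (insert u T) → ¬ f (insert v T) → (T, s(u, v)) ∈ Z)
    (S : Finset V) (a b : V) (hS : S.card + 1 = k) (ha : a ∉ S) (hb : b ∉ S) (hab : G.Adj a b)
    (hfa : f (insert a S)) (hfb : ¬ f (insert b S)) :
    k * (t - k + 1) ≤ Z.card := by
  have hrest := aux_rest G t k h f Z hZ S a b hS ha hb hab hfa hfb
  have hane : a ≠ b := hab.ne
  have hZ' : ∀ (T : Finset V) u v, T.card + 1 = k → u ∉ T → v ∉ T → G.Adj u v →
      (T, s(u, v)) ∉ Z → (f (insert u T) ↔ f (insert v T)) := by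
    intro T u v hT hu hv huv hn
    by_contra hc
    by_cases h1 : f (insert u T)
    · exact hn (hZ T u v hT hu hv huv h1 (fun h2 => hc ⟨fun _ => h2, fun _ => h1⟩))
    · rw [Sym2.eq_swap] at hn
      exact hn (hZ T v u hT hv hu huv.symm (by tauto) h1)
  set Z3 := Z.filter fun p => p.2 ≠ s(a, b) ∧ ¬ auxP1 S a b p.2 ∧ ¬ auxP2 S a b p with hZ3
  set Z1 := Z.filter fun p => auxP1 S a b p.2 with hZ1
  set Z2 := Z.filter fun p => auxP2 S a b p with hZ2
  set Z0 : Finset (Finset V × Sym2 V) := {(S, s(a, b))} with hZ0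
  set C := S.filter fun s => G.Adj a s ∧ G.Adj b s with hC
  let N : V → Finset V := fun s => univ.filter fun w => G.Adj s w ∧ w ∉ S ∧ w ≠ a ∧ w ≠ b
  set D := S.sigma N with hD
  have hcardE : ∀ s ∈ S, ∀ c, c ∉ S → (insert c (S.erase s)).card + 1 = k := by
    intro s hs c hc
    have : 0 < S.card := Finset.card_pos.mpr ⟨s, hs⟩
    rw [card_insert_of_notMem (by simp [hc]), card_erase_of_mem hs]; omega
  have hins : ∀ s ∈ S, ∀ c, insert s (insert c (S.erase s)) = insert c S := by
    intro s hs c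
    rw [Finset.insert_comm, insert_erase hs]
  have hnotS : ∀ s ∈ S, ∀ c, c ∉ S → s ∉ insert c (S.erase s) := by
    intro s hs c hc
    simp only [mem_insert, mem_erase]
    rintro (e | e)
    · exact hc (e ▸ hs)
    · exact e.1 rfl
  -- C bound
  have hC1 : C.card ≤ Z1.card := by
    have hex : ∀ s ∈ C, ∃ p ∈ Z, p.2 = s(a, s) ∨ p.2 = s(b, s) := by
      intro s hs
      obtain ⟨hsS, has, hbs⟩ := mem_filter.1 hs
      by_contra hno
      push Not at hno
      have e1 := hZ' (insert a (S.erase s)) s b (hcardE s hsS a ha) (hnotS s hsS a ha)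
        (by simp [hb, hane.symm]) hbs.symm
        (fun hm => (hno _ hm).2 Sym2.eq_swap)
      have e2 := hZ' (insert b (S.erase s)) a s (hcardE s hsS b hb)
        (by simp [ha, hane]) (hnotS s hsS b hb) has
        (fun hm => (hno _ hm).1 rfl)
      rw [hins s hsS] at e1 e2
      rw [Finset.insert_comm] at e2
      exact hfb (e2.1 (e1.1 hfa))
    have : Nonempty (Finset V × Sym2 V) := ⟨(S, s(a, b))⟩
    choose! g hg hg' using hex
    refine card_le_card_of_injOn g ?_ ?_
    · intro s hs
      exact mem_filter.2 ⟨hg s hs, s, (mem_filter.1 hs).1, hg' s hs⟩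
    · intro s hs s' hs' e
      have hsS := (mem_filter.1 hs).1
      have hsS' := (mem_filter.1 hs').1
      have q := hg' s hs
      have q' := hg' s' hs'
      rw [← e] at q'
      have hsa : s ≠ a := fun e => ha (e ▸ hsS)
      have hsb : s ≠ b := fun e => hb (e ▸ hsS)
      have hsa' : s' ≠ a := fun e => ha (e ▸ hsS')
      have hsb' : s' ≠ b := fun e => hb (e ▸ hsS')
      rcases q with q | q <;> rcases q' with q' | q' <;> rw [q, Sym2.eq_iff] at q' <;> grind
  -- D bound
  have hD1 : D.card ≤ Z2.card := by
    have hex : ∀ d ∈ D, ∃ p ∈ Z, auxQ2 S a b d.1 d.2 p := by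
      rintro ⟨s, w⟩ hd
      obtain ⟨hsS, hwN⟩ := mem_sigma.1 hd
      obtain ⟨-, hsw, hwS, hwa, hwb⟩ := mem_filter.1 hwN
      simp only at hsS hsw hwS hwa hwb ⊢
      by_contra hno
      push Not at hno
      have e1 := hZ' (insert a (S.erase s)) s w (hcardE s hsS a ha) (hnotS s hsS a ha)
        (by simp [hwS, hwa]) hsw (fun hm => hno _ hm (Or.inl rfl))
      have e2 := hZ' (insert b (S.erase s)) s w (hcardE s hsS b hb) (hnotS s hsS b hb)
        (by simp [hwS, hwb]) hsw (fun hm => hno _ hm (Or.inr (Or.inl rfl)))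
      have e3 := hZ' (insert w (S.erase s)) a b (hcardE s hsS w hwS)
        (by simp [ha, hwa.symm]) (by simp [hb, hwb.symm]) hab
        (fun hm => hno _ hm (Or.inr (Or.inr rfl)))
      rw [hins s hsS, Finset.insert_comm] at e1 e2
      exact hfb (e2.2 (e3.1 (e1.1 hfa)))
    have : Nonempty (Finset V × Sym2 V) := ⟨(S, s(a, b))⟩
    choose! g hg hg' using hex
    refine card_le_card_of_injOn g ?_ ?_
    · rintro ⟨s, w⟩ hd
      obtain ⟨hsS, hwN⟩ := mem_sigma.1 hd
      obtain ⟨-, hsw, hwS, hwa, hwb⟩ := mem_filter.1 hwN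
      exact mem_filter.2 ⟨hg _ hd, s, w, hsS, hwS, hwa, hwb, hg' _ hd⟩
    · rintro ⟨s, w⟩ hd ⟨s', w'⟩ hd' e
      obtain ⟨hsS, hwN⟩ := mem_sigma.1 hd
      obtain ⟨-, hsw, hwS, hwa, hwb⟩ := mem_filter.1 hwN
      obtain ⟨hsS', hwN'⟩ := mem_sigma.1 hd'
      obtain ⟨-, hsw', hwS', hwa', hwb'⟩ := mem_filter.1 hwN'
      have q := hg' _ hd
      have q' := hg' _ hd'
      rw [← e] at q'
      obtain ⟨r1, r2⟩ := aux_Q2_inj S a b ha hb s w s' w' hsS hwS hsS' hwS' _ q q'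
      subst r1; subst r2; rfl
  -- degrees
  have hdeg : ∀ s ∈ S, t - k + 1 ≤ (N s).card + if G.Adj a s ∧ G.Adj b s then 1 else 0 := by
    intro s hsS
    have hsa : s ≠ a := fun e => ha (e ▸ hsS)
    have hSc : 0 < S.card := Finset.card_pos.mpr ⟨s, hsS⟩
    have hce := card_erase_of_mem hsS
    by_cases hcc : G.Adj a s ∧ G.Adj b s
    · rw [if_pos hcc]
      have h1 := aux_deg G t h s a hsa (N s ∪ insert a (insert b (S.erase s))) (by
        intro u hu
        have := hu.ne
        simp only [N, mem_union, mem_filter, mem_univ, true_and, mem_insert, mem_erase]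
        grind)
      have h2 := card_union_le (N s) (insert a (insert b (S.erase s)))
      have h3 := card_insert_le a (insert b (S.erase s))
      have h4 := card_insert_le b (S.erase s)
      omega
    · rw [if_neg hcc]
      obtain ⟨c, hc⟩ : ∃ c, ∀ u, G.Adj s u → u = a ∨ u = b → u = c := by
        by_cases h1 : G.Adj a s
        · refine ⟨a, fun u hu => ?_⟩
          rintro (rfl | rfl)
          · rfl
          · exact absurd ⟨h1, hu.symm⟩ hcc
        · refine ⟨b, fun u hu => ?_⟩
          rintro (rfl | rfl)
          · exact absurd hu.symm h1
          · rfl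
      have h1 := aux_deg G t h s a hsa (N s ∪ insert c (S.erase s)) (by
        intro u hu
        have := hu.ne
        have := hc u hu
        simp only [N, mem_union, mem_filter, mem_univ, true_and, mem_insert, mem_erase]
        grind)
      have h2 := card_union_le (N s) (insert c (S.erase s))
      have h3 := card_insert_le c (S.erase s)
      omega
  have hDC : S.card * (t - k + 1) ≤ D.card + C.card := by
    rw [hD, hC, card_sigma, card_filter, ← sum_add_distrib, ← smul_eq_mul]
    exact card_nsmul_le_sum _ _ _ hdeg
  -- disjoint union
  have hSab : ∀ s ∈ S, ∀ w, s(s, w) ≠ s(a, b) := by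
    intro s hs w e
    rcases Sym2.eq_iff.1 e with ⟨rfl, rfl⟩ | ⟨rfl, rfl⟩
    · exact ha hs
    · exact hb hs
  have hP1ab : ¬ auxP1 S a b s(a, b) := by
    rintro ⟨s, hs, e | e⟩
    · exact hSab s hs a (by rw [Sym2.eq_swap]; exact e.symm)
    · exact hSab s hs b (by rw [Sym2.eq_swap]; exact e.symm)
  have hP12 : ∀ p, auxP1 S a b p.2 → ¬ auxP2 S a b p := by
    rintro ⟨T, e⟩ h1 ⟨s, w, hs, hw, hwa, hwb, h2 | h2 | h2⟩
    · obtain ⟨-, rfl⟩ := Prod.mk.inj h2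
      obtain ⟨s', hs', e | e⟩ := h1 <;> rw [Sym2.eq_iff] at e <;> grind
    · obtain ⟨-, rfl⟩ := Prod.mk.inj h2
      obtain ⟨s', hs', e | e⟩ := h1 <;> rw [Sym2.eq_iff] at e <;> grind
    · obtain ⟨-, rfl⟩ := Prod.mk.inj h2
      exact hP1ab h1
  have hP02 : ¬ auxP2 S a b (S, s(a, b)) := by
    rintro ⟨s, w, hs, hw, hwa, hwb, h2 | h2 | h2⟩
    · exact hSab s hs w (Prod.mk.inj h2).2.symm
    · exact hSab s hs w (Prod.mk.inj h2).2.symm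
    · have := (Prod.mk.inj h2).1
      exact hw (by rw [this]; simp)
  have d12 : Disjoint Z1 Z2 := by
    rw [Finset.disjoint_left]
    intro p h1 h2
    exact hP12 p (mem_filter.1 h1).2 (mem_filter.1 h2).2
  have d123 : Disjoint (Z1 ∪ Z2) Z3 := by
    rw [Finset.disjoint_left]
    intro p h1 h3
    have := (mem_filter.1 h3).2
    rcases mem_union.1 h1 with h1 | h1
    · exact this.2.1 (mem_filter.1 h1).2
    · exact this.2.2 (mem_filter.1 h1).2
  have d0 : (S, s(a, b)) ∉ (Z1 ∪ Z2) ∪ Z3 := by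
    intro hm
    rcases mem_union.1 hm with hm | hm
    · rcases mem_union.1 hm with hm | hm
      · exact hP1ab (mem_filter.1 hm).2
      · exact hP02 (mem_filter.1 hm).2
    · exact (mem_filter.1 hm).2.1 rfl
  have hsub : insert (S, s(a, b)) ((Z1 ∪ Z2) ∪ Z3) ⊆ Z := by
    intro p hp
    rcases mem_insert.1 hp with rfl | hp
    · exact hZ S a b hS ha hb hab hfa hfb
    · rcases mem_union.1 hp with hm | hm
      · rcases mem_union.1 hm with hm | hm <;> exact (mem_filter.1 hm).1
      · exact (mem_filter.1 hm).1
  have hfin := card_le_card hsub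
  rw [card_insert_of_notMem d0, card_union_of_disjoint d123, card_union_of_disjoint d12] at hfin
  have : k * (t - k + 1) = S.card * (t - k + 1) + (t - k + 1) := by
    rw [← hS]; ring
  omega

theorem aux_adj [DecidableEq V] (G : SimpleGraph V) (k : ℕ) (T : Finset V) (u v : V)
    (hu : u ∉ T) (hv : v ∉ T) (huv : G.Adj u v) (h1 : (insert u T).card = k)
    (h2 : (insert v T).card = k) :
    (tokenGraph G k).Adj ⟨insert u T, h1⟩ ⟨insert v T, h2⟩ := by
  have hne := huv.ne
  rw [tokenGraph, SimpleGraph.fromRel_adj]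
  refine ⟨?_, Or.inl ⟨u, v, huv, ?_⟩⟩
  · intro e
    have e' : insert u T = insert v T := congrArg Subtype.val e
    have : u ∈ insert v T := by rw [← e']; simp
    simp [hne, hu] at this
  · ext w
    simp only [mem_symmDiff, mem_insert, mem_singleton]
    grind

theorem aux_map_inj [DecidableEq V] (T T' : Finset V) (u v u' v' : V)
    (hu : u ∉ T) (hv : v ∉ T) (huv : u ≠ v) (hu' : u' ∉ T') (hv' : v' ∉ T') (huv' : u' ≠ v')
    (h : s(insert u T, insert v T) = s(insert u' T', insert v' T')) :
    T = T' ∧ s(u, v) = s(u', v') := by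
  have hI : ∀ (T : Finset V) u v, u ∉ T → v ∉ T → u ≠ v → insert u T ∩ insert v T = T := by
    intro T u v hu hv huv
    ext w; simp only [mem_inter, mem_insert]; grind
  have hT : T = T' := by
    rcases Sym2.eq_iff.1 h with ⟨e1, e2⟩ | ⟨e1, e2⟩
    · rw [← hI T u v hu hv huv, e1, e2, hI T' u' v' hu' hv' huv']
    · rw [← hI T u v hu hv huv, e1, e2, hI T' v' u' hv' hu' huv'.symm]
  subst hT
  have hJ : ∀ u v : V, u ∉ T → insert u T = insert v T → u = v := by
    intro u v hu e
    have : u ∈ insert v T := by rw [← e]; simp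
    simpa [hu] using this
  refine ⟨rfl, ?_⟩
  rcases Sym2.eq_iff.1 h with ⟨e1, e2⟩ | ⟨e1, e2⟩
  · rw [hJ _ _ hu e1, hJ _ _ hv e2]
  · rw [hJ _ _ hu e1, hJ _ _ hv e2, Sym2.eq_swap]

theorem aux_token [Fintype V] [DecidableEq V] (G : SimpleGraph V) (t k : ℕ) (hG : G.Connected)
    (h : EdgeConnected G t) (hk1 : 1 ≤ k) (hkt : k ≤ t) (hkV : k ≤ Fintype.card V) :
    EdgeConnected (tokenGraph G k) (k * (t - k + 1)) := by
  intro F hF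
  set K := (tokenGraph G k).deleteEdges (F : Set (Sym2 {s : Finset V // s.card = k})) with hK
  obtain ⟨A0, -, hA0⟩ := Finset.exists_subset_card_eq (s := (univ : Finset V)) (n := k)
    (by rw [card_univ]; exact hkV)
  by_contra hnc
  have hex : ∃ X Y, ¬ K.Reachable X Y := by
    by_contra hno
    push Not at hno
    have : Nonempty {s : Finset V // s.card = k} := ⟨⟨A0, hA0⟩⟩
    exact hnc ⟨hno⟩
  obtain ⟨X, Y, hXY⟩ := hex
  let f : Finset V → Prop := fun A => ∃ hA : A.card = k, K.Reachable X ⟨A, hA⟩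
  have hcr : ∀ (T : Finset V) u v, T.card + 1 = k → u ∉ T → v ∉ T → G.Adj u v →
      f (insert u T) → ¬ f (insert v T) →
      ∃ e ∈ F, Sym2.map Subtype.val e = s(insert u T, insert v T) := by
    intro T u v hT hu hv huv ⟨hA, hr⟩ hfv
    have hB : (insert v T).card = k := by rw [card_insert_of_notMem hv, hT]
    refine ⟨s(⟨insert u T, hA⟩, ⟨insert v T, hB⟩), ?_, by simp⟩
    by_contra hnF
    apply hfv
    refine ⟨hB, hr.trans (SimpleGraph.Adj.reachable ?_)⟩
    rw [hK, SimpleGraph.deleteEdges_adj]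
    exact ⟨aux_adj G k T u v hu hv huv hA hB, by simpa using hnF⟩
  let Z : Finset (Finset V × Sym2 V) := univ.filter fun p => ∃ u v, p.2 = s(u, v) ∧ u ∉ p.1 ∧
    v ∉ p.1 ∧ u ≠ v ∧ ∃ e ∈ F, Sym2.map Subtype.val e = s(insert u p.1, insert v p.1)
  have hZF : Z.card ≤ F.card := by
    have hex : ∀ p ∈ Z, ∃ e ∈ F, ∃ u v, p.2 = s(u, v) ∧ u ∉ p.1 ∧
        v ∉ p.1 ∧ u ≠ v ∧ Sym2.map Subtype.val e = s(insert u p.1, insert v p.1) := by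
      intro p hp
      obtain ⟨-, u, v, h1, h2, h3, h4, e, h5, h6⟩ := mem_filter.1 hp
      exact ⟨e, h5, u, v, h1, h2, h3, h4, h6⟩
    have : Nonempty (Sym2 {s : Finset V // s.card = k}) := ⟨s(X, X)⟩
    choose! g hg hg' using hex
    refine card_le_card_of_injOn g (fun p hp => hg p hp) ?_
    intro p hp q hq e
    obtain ⟨u, v, h1, h2, h3, h4, h5⟩ := hg' p hp
    obtain ⟨u', v', h1', h2', h3', h4', h5'⟩ := hg' q hq
    rw [e, h5'] at h5
    obtain ⟨r1, r2⟩ := aux_map_inj _ _ _ _ _ _ h2' h3' h4' h2 h3 h4 h5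
    exact Prod.ext r1.symm (by rw [h1, h1', r2])
  have hZ : ∀ (T : Finset V) u v, T.card + 1 = k → u ∉ T → v ∉ T → G.Adj u v →
      f (insert u T) → ¬ f (insert v T) → (T, s(u, v)) ∈ Z := by
    intro T u v hT hu hv huv h1 h2
    exact mem_filter.2 ⟨mem_univ _, u, v, rfl, hu, hv, huv.ne, hcr T u v hT hu hv huv h1 h2⟩
  have hcross : ∃ (S : Finset V) (a b : V), S.card + 1 = k ∧ a ∉ S ∧ b ∉ S ∧ G.Adj a b ∧
      f (insert a S) ∧ ¬ f (insert b S) := by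
    by_contra hno
    push Not at hno
    have := aux_const G hG f (k - 1) (fun T u v hT hu hv huv =>
      ⟨hno T u v (by omega) hu hv huv, hno T v u (by omega) hv hu huv.symm⟩) _ X.1 Y.1
      (by rw [X.2]; omega) (by rw [Y.2]; omega) rfl
    obtain ⟨_, hr⟩ := this.1 ⟨X.2, SimpleGraph.Reachable.refl _⟩
    exact hXY hr
  obtain ⟨S, a, b, hS, ha, hb, hab, hfa, hfb⟩ := hcross
  have := aux_core G t k h hkt f Z hZ S a b hS ha hb hab hfa hfb
  omega

theorem aux_le_minDegree {W : Type*} [Fintype W] (H : SimpleGraph W) [DecidableRel H.Adj]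
    [Nontrivial W] (t : ℕ) (h : EdgeConnected H t) : t ≤ H.minDegree := by
  obtain ⟨v, hv⟩ := H.exists_minimal_degree_vertex
  obtain ⟨w, hw⟩ := exists_ne v
  rw [hv]
  exact aux_deg H t h v w hw.symm (H.neighborFinset v) (by simp)

theorem stmt6 [Fintype V] [DecidableEq V] (G : SimpleGraph V) (n k : ℕ)
    (hn : Fintype.card V = n) (hG : G.Connected) (hk1 : 1 ≤ k) (hkn : k ≤ n - 1)
    (hkl : k ≤ edgeConn G)
    (hδ : (tokenGraph G k).minDegree = k * (edgeConn G - k + 1)) :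
    edgeConn (tokenGraph G k) = (tokenGraph G k).minDegree := by
  have : Nontrivial V := Fintype.one_lt_card_iff_nontrivial.1 (by omega)
  have hmem : EdgeConnected G (edgeConn G) := by
    have := Nat.sSup_mem (s := {t | EdgeConnected G t}) ⟨0, fun F hF => absurd hF (by omega)⟩
      ⟨G.minDegree, fun t ht => aux_le_minDegree G t ht⟩
    exact this
  have : Nontrivial {s : Finset V // s.card = k} := by
    apply Fintype.one_lt_card_iff_nontrivial.1
    rw [Fintype.card_finset_len]
    have h1 : n.choose 1 ≤ n.choose k ∨ 1 < n.choose k := by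
      right
      have hlt : k < n := by omega
      have h2 : 0 < (n - 1).choose k := Nat.choose_pos (by omega)
      have h3 : 0 < (n - 1).choose (k - 1) := Nat.choose_pos (by omega)
      obtain ⟨m, rfl⟩ : ∃ m, n = m + 1 := ⟨n - 1, by omega⟩
      obtain ⟨j, rfl⟩ : ∃ j, k = j + 1 := ⟨k - 1, by omega⟩
      rw [Nat.choose_succ_succ]
      simp only [Nat.add_sub_cancel] at h2 h3
      simp only [Nat.succ_eq_add_one]
      omega
    rw [hn]
    rcases h1 with h1 | h1
    · rw [Nat.choose_one_right] at h1; omega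
    · exact h1
  have hlow := aux_token G (edgeConn G) k hG hmem hk1 hkl (by omega)
  apply le_antisymm
  · exact csSup_le ⟨0, fun F hF => absurd hF (by omega)⟩
      (fun t ht => aux_le_minDegree _ t ht)
  · rw [hδ]
    exact le_csSup ⟨(tokenGraph G k).minDegree, fun t ht => aux_le_minDegree _ t ht⟩ hlow
end
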